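/- There exists a constant C > 0 such that for every prime p with p ≡ 3 (mod 4) and every natural number t with t ≥ C·p, and for every i ∈ F_p, the total variation distance between the distribution of the random walk after t steps started at i and π is at most 1/(2e): (1/2)·∑_{j ∈ F_p} |(A^t)(i,j) − π(j)| ≤ 1/(2e). In particular, the mixing time of the random walk by the unit circle is O(p). -/

import Mathlib

open Finset

/-- The circle of quadrance `K` centered at the origin in `F_p × F_p`. -/
def circ (p : ℕ) [NeZero p] (K : ZMod p) : Finset (ZMod p × ZMod p) :=
  Finset.univ.filter (fun v => v.1 ^ 2 + v.2 ^ 2 = K)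

/-- `N_{ij}^k`: the number of pairs `(a, b)` with `a ∈ C_i`, `b ∈ C_j`, `a + b ∈ C_k`. -/
def Ncirc (p : ℕ) [NeZero p] (i j k : ZMod p) : ℕ :=
  ((circ p i ×ˢ circ p j).filter (fun ab => ab.1 + ab.2 ∈ circ p k)).card

/-- The random-walk kernel of the unit circle: `A(i,j) = N_{i1}^j / (|C_i|·|C_1|)`. -/
noncomputable def kerA (p : ℕ) [NeZero p] : Matrix (ZMod p) (ZMod p) ℝ :=
  fun i j => (Ncirc p i 1 j : ℝ) / (((circ p i).card : ℝ) * ((circ p 1).card : ℝ))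

/-- The stationary distribution: `π(0) = 1/p²`, `π(j) = (p+1)/p²` for `j ≠ 0`. -/
noncomputable def piDist (p : ℕ) [NeZero p] (j : ZMod p) : ℝ :=
  if j = 0 then 1 / (p : ℝ) ^ 2 else ((p : ℝ) + 1) / (p : ℝ) ^ 2

lemma circ_mem {p : ℕ} [NeZero p] {K : ZMod p} {v : ZMod p × ZMod p} :
    v ∈ circ p K ↔ v.1 ^ 2 + v.2 ^ 2 = K := by
  simp [circ]

lemma sq_sum_zero {p : ℕ} [Fact p.Prime] (hp : p % 4 = 3) {x y : ZMod p}
    (h : x ^ 2 + y ^ 2 = 0) : x = 0 ∧ y = 0 := by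
  have key : ∀ {x y : ZMod p}, x ^ 2 + y ^ 2 = 0 → y = 0 := by
    intro x y h
    by_contra hy
    have : IsSquare (-1 : ZMod p) := by
      refine ⟨x / y, ?_⟩
      field_simp
      linear_combination -h
    exact (ZMod.exists_sq_eq_neg_one_iff.mp this) hp
  exact ⟨key (x := y) (by linear_combination h), key h⟩

lemma circ_zero {p : ℕ} [Fact p.Prime] (hp : p % 4 = 3) : circ p 0 = {(0, 0)} := by
  ext ⟨x, y⟩
  rw [circ_mem, Finset.mem_singleton, Prod.mk.injEq]
  constructor
  · exact fun h => sq_sum_zero hp h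
  · rintro ⟨rfl, rfl⟩; simp

lemma circ_card_eq {p : ℕ} [Fact p.Prime] {K : ZMod p} (hK : K ≠ 0) :
    (circ p K).card = (circ p 1).card := by
  obtain ⟨c, d, h⟩ := ZMod.sq_add_sq p K
  symm
  refine Finset.card_bij' (fun v _ => (v.1 * c - v.2 * d, v.1 * d + v.2 * c))
    (fun v _ => ((v.1 * c + v.2 * d) / K, (v.2 * c - v.1 * d) / K)) ?_ ?_ ?_ ?_
  · rintro ⟨x, y⟩ hv
    rw [circ_mem] at hv ⊢
    simp only at hv ⊢
    linear_combination (c ^ 2 + d ^ 2) * hv + h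
  · rintro ⟨x, y⟩ hv
    rw [circ_mem] at hv ⊢
    simp only at hv ⊢
    field_simp
    linear_combination (c ^ 2 + d ^ 2) * hv + K * h
  · rintro ⟨x, y⟩ hv
    ext
    · simp only
      field_simp
      linear_combination x * h
    · simp only
      field_simp
      linear_combination y * h
  · rintro ⟨x, y⟩ hv
    ext
    · simp only
      field_simp
      linear_combination x * h
    · simp only
      field_simp
      linear_combination y * h

lemma circ_card {p : ℕ} [Fact p.Prime] (hp : p % 4 = 3) {K : ZMod p} (hK : K ≠ 0) :
    (circ p K).card = p + 1 := by
  rw [circ_card_eq hK]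
  have h1 : ∑ K : ZMod p, (circ p K).card = p ^ 2 := by
    have := Finset.card_eq_sum_card_fiberwise (s := (Finset.univ : Finset (ZMod p × ZMod p)))
      (t := (Finset.univ : Finset (ZMod p))) (f := fun v => v.1 ^ 2 + v.2 ^ 2) (by simp)
    simp only [Finset.card_univ, Fintype.card_prod, ZMod.card] at this
    rw [sq, this]
    rfl
  rw [← Finset.add_sum_erase _ _ (Finset.mem_univ (0 : ZMod p)), circ_zero hp,
    Finset.sum_congr rfl (fun K hK => circ_card_eq (Finset.ne_of_mem_erase hK)),
    Finset.sum_const, Finset.card_erase_of_mem (Finset.mem_univ _), Finset.card_univ,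
    ZMod.card] at h1
  simp only [Finset.card_singleton, smul_eq_mul] at h1
  have hp2 : 2 ≤ p := (Fact.out : p.Prime).two_le
  obtain ⟨q, rfl⟩ : ∃ q, p = q + 2 := ⟨p - 2, by omega⟩
  have : (q + 1) * (circ (q + 2) 1).card = (q + 1) * (q + 3) := by
    have h2 : q + 2 - 1 = q + 1 := by omega
    rw [h2] at h1
    nlinarith
  have := Nat.eq_of_mul_eq_mul_left (Nat.succ_pos q) this
  omega

lemma circ_card_ne {p : ℕ} [Fact p.Prime] (hp : p % 4 = 3) (K : ZMod p) :
    ((circ p K).card : ℝ) ≠ 0 := by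
  by_cases hK : K = 0
  · subst hK; rw [circ_zero hp]; simp
  · rw [circ_card hp hK]; positivity

lemma piDist_eq {p : ℕ} [Fact p.Prime] (hp : p % 4 = 3) (K : ZMod p) :
    piDist p K = (circ p K).card / (p : ℝ) ^ 2 := by
  unfold piDist
  split_ifs with h
  · subst h; rw [circ_zero hp]; simp
  · rw [circ_card hp h]; push_cast; rfl

lemma sum_Ncirc_right {p : ℕ} [Fact p.Prime] (i : ZMod p) :
    ∑ j, Ncirc p i 1 j = (circ p i).card * (circ p 1).card := by
  rw [← Finset.card_product]
  rw [Finset.card_eq_sum_card_fiberwise (s := circ p i ×ˢ circ p 1)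
      (t := (Finset.univ : Finset (ZMod p)))
      (f := fun ab => (ab.1 + ab.2).1 ^ 2 + (ab.1 + ab.2).2 ^ 2) (by simp)]
  refine Finset.sum_congr rfl fun j _ => ?_
  unfold Ncirc
  congr 1
  ext ab
  simp [circ_mem]

lemma sum_Ncirc_left {p : ℕ} [Fact p.Prime] (j : ZMod p) :
    ∑ i, Ncirc p i 1 j = (circ p j).card * (circ p 1).card := by
  rw [← Finset.card_product]
  rw [Finset.card_eq_sum_card_fiberwise (s := circ p j ×ˢ circ p 1)
      (t := (Finset.univ : Finset (ZMod p)))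
      (f := fun ab => (ab.1 - ab.2).1 ^ 2 + (ab.1 - ab.2).2 ^ 2) (by simp)]
  refine Finset.sum_congr rfl fun i _ => ?_
  unfold Ncirc
  refine Finset.card_bij' (fun ab _ => (ab.1 + ab.2, ab.2)) (fun ab _ => (ab.1 - ab.2, ab.2))
    ?_ ?_ ?_ ?_
  · rintro ⟨a, b⟩ h
    simp only [Finset.mem_filter, Finset.mem_product] at h ⊢
    refine ⟨⟨h.2, h.1.2⟩, ?_⟩
    rw [add_sub_cancel_right]
    exact circ_mem.mp h.1.1
  · rintro ⟨a, b⟩ h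
    simp only [Finset.mem_filter, Finset.mem_product] at h ⊢
    refine ⟨⟨circ_mem.mpr h.2, h.1.2⟩, ?_⟩
    rw [sub_add_cancel]
    exact h.1.1
  · rintro ⟨a, b⟩ h; simp
  · rintro ⟨a, b⟩ h; simp

lemma kerA_nonneg {p : ℕ} [Fact p.Prime] (i j : ZMod p) : 0 ≤ kerA p i j := by
  unfold kerA; positivity

lemma kerA_row {p : ℕ} [Fact p.Prime] (hp : p % 4 = 3) (i : ZMod p) :
    ∑ j, kerA p i j = 1 := by
  unfold kerA
  rw [← Finset.sum_div, ← Nat.cast_sum, sum_Ncirc_right, Nat.cast_mul]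
  exact div_self (mul_ne_zero (circ_card_ne hp i) (circ_card_ne hp 1))

lemma piDist_sum {p : ℕ} [Fact p.Prime] (hp : p % 4 = 3) : ∑ j, piDist p j = 1 := by
  have hp0 : (p : ℝ) ≠ 0 := by exact_mod_cast (Fact.out : p.Prime).ne_zero
  unfold piDist
  rw [← Finset.add_sum_erase _ _ (Finset.mem_univ (0 : ZMod p)),
    Finset.sum_congr rfl (fun K hK => if_neg (Finset.ne_of_mem_erase hK)),
    Finset.sum_const, Finset.card_erase_of_mem (Finset.mem_univ _), Finset.card_univ,
    ZMod.card, if_pos rfl, nsmul_eq_mul, Nat.cast_sub (Fact.out : p.Prime).one_le]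
  field_simp
  push_cast
  ring

lemma piDist_nonneg {p : ℕ} [Fact p.Prime] (j : ZMod p) : 0 ≤ piDist p j := by
  unfold piDist; split_ifs <;> positivity

lemma piDist_stat {p : ℕ} [Fact p.Prime] (hp : p % 4 = 3) (j : ZMod p) :
    ∑ i, piDist p i * kerA p i j = piDist p j := by
  have h : ∀ i, piDist p i * kerA p i j =
      (Ncirc p i 1 j : ℝ) / ((p : ℝ) ^ 2 * ((circ p 1).card : ℝ)) := by
    intro i
    rw [piDist_eq hp]
    unfold kerA
    have := circ_card_ne hp i
    have := circ_card_ne hp (1 : ZMod p)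
    field_simp
  rw [Finset.sum_congr rfl (fun i _ => h i), ← Finset.sum_div, ← Nat.cast_sum, sum_Ncirc_left,
    piDist_eq hp, Nat.cast_mul, mul_div_mul_right _ _ (circ_card_ne hp 1)]

lemma card_sq_le {p : ℕ} [Fact p.Prime] (K : ZMod p) :
    (Finset.univ.filter (fun d : ZMod p => d ^ 2 = K)).card ≤ 2 := by
  by_cases h : ∃ e : ZMod p, e ^ 2 = K
  · obtain ⟨e, rfl⟩ := h
    calc _ ≤ ({e, -e} : Finset (ZMod p)).card := by
          refine Finset.card_le_card fun d hd => ?_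
          simp only [Finset.mem_filter, Finset.mem_univ, true_and] at hd
          simpa using sq_eq_sq_iff_eq_or_eq_neg.mp hd
      _ ≤ 2 := Finset.card_le_two
  · rw [Finset.filter_eq_empty_iff.mpr]
    · simp
    · intro d _ hd
      exact h ⟨d, hd⟩

lemma two_ne {p : ℕ} [Fact p.Prime] (hp : p % 4 = 3) : (2 : ZMod p) ≠ 0 := by
  haveI : Fact (2 < p) := ⟨by
    have := (Fact.out : p.Prime).two_le
    omega⟩
  have := ZMod.natCast_eq_zero_iff 2 p
  intro h
  have h2 : p ∣ 2 := this.mp (by exact_mod_cast h)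
  have := Nat.le_of_dvd (by norm_num) h2
  have : 2 < p := Fact.out
  omega

lemma Ncirc_le {p : ℕ} [Fact p.Prime] (hp : p % 4 = 3) {i : ZMod p} (hi : i ≠ 0) (j : ZMod p) :
    Ncirc p i 1 j ≤ 2 * (circ p i).card := by
  unfold Ncirc
  refine Finset.card_le_mul_card_image_of_maps_to (f := Prod.fst) (t := circ p i) ?_ 2 ?_
  · rintro ⟨a, b⟩ h
    simp only [Finset.mem_filter, Finset.mem_product] at h
    exact h.1.1
  · rintro ⟨a₁, a₂⟩ ha
    rw [circ_mem] at ha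
    simp only at ha
    have h2 := two_ne hp
    refine le_trans ?_ (card_sq_le (i - ((j - i - 1) / 2) ^ 2))
    have key : ∀ x ∈ Finset.filter (fun x : (ZMod p × ZMod p) × (ZMod p × ZMod p) => x.1 = (a₁, a₂))
        (Finset.filter (fun ab => ab.1 + ab.2 ∈ circ p j) (circ p i ×ˢ circ p 1)),
        x.1 = (a₁, a₂) ∧ x.2.1 ^ 2 + x.2.2 ^ 2 = 1 ∧
          x.2.1 * a₁ + x.2.2 * a₂ = (j - i - 1) / 2 := by
      rintro ⟨a, ⟨b₁, b₂⟩⟩ h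
      simp only [Finset.mem_filter, Finset.mem_product, circ_mem] at h
      obtain ⟨⟨⟨h1, h3⟩, h4⟩, rfl⟩ := h
      simp only [Prod.mk_add_mk] at h1 h3 h4
      refine ⟨rfl, h3, ?_⟩
      simp only
      field_simp
      linear_combination h4 - h1 - h3
    refine Finset.card_le_card_of_injOn (fun x => x.2.1 * a₂ - x.2.2 * a₁) ?_ ?_
    · intro x hx
      obtain ⟨-, h3, h4⟩ := key x hx
      simp only [Finset.coe_filter, Finset.mem_univ, true_and, Set.mem_setOf_eq]
      rw [← h4, ← ha]
      linear_combination (a₁ ^ 2 + a₂ ^ 2) * h3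
    · rintro ⟨a, ⟨b₁, b₂⟩⟩ hx ⟨a', ⟨c₁, c₂⟩⟩ hy hxy
      obtain ⟨e1, h3, h4⟩ := key _ hx
      obtain ⟨e2, h5, h6⟩ := key _ hy
      simp only at e1 e2 h3 h4 h5 h6 hxy
      subst e1 e2
      have hc := h4.trans h6.symm
      have r1 : b₁ = c₁ := by
        apply mul_left_cancel₀ hi
        rw [← ha]
        linear_combination a₁ * hc + a₂ * hxy
      have r2 : b₂ = c₂ := by
        apply mul_left_cancel₀ hi
        rw [← ha]
        linear_combination a₂ * hc - a₁ * hxy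
      rw [r1, r2]

lemma Ncirc_zero_le {p : ℕ} [Fact p.Prime] (hp : p % 4 = 3) (i : ZMod p) :
    Ncirc p i 1 0 ≤ (circ p i).card := by
  unfold Ncirc
  refine Finset.card_le_card_of_injOn Prod.fst ?_ ?_
  · rintro ⟨a, b⟩ h
    simp only [Finset.coe_filter, Finset.mem_product, Set.mem_setOf_eq] at h
    exact h.1.1
  · rintro ⟨a, b⟩ h ⟨a', b'⟩ h' e
    rw [circ_zero hp] at h h'
    simp only [Finset.coe_filter, Finset.mem_product, Set.mem_setOf_eq, Finset.mem_singleton]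
      at h h' e
    subst e
    have := h.2.trans h'.2.symm
    rw [add_left_cancel this]

lemma Ncirc_zero_left {p : ℕ} [Fact p.Prime] (hp : p % 4 = 3) {j : ZMod p} (hj : j ≠ 1) :
    Ncirc p 0 1 j = 0 := by
  unfold Ncirc
  rw [Finset.card_eq_zero, Finset.filter_eq_empty_iff]
  rintro ⟨a, b⟩ h hab
  rw [circ_zero hp] at h
  simp only [Finset.mem_product, Finset.mem_singleton] at h
  obtain ⟨rfl, hb⟩ := h
  rw [circ_mem] at hab hb
  simp only [Prod.fst_add, Prod.snd_add, zero_add] at hab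
  exact hj (hab.symm.trans hb)

lemma kerA_le {p : ℕ} [Fact p.Prime] (hp : p % 4 = 3) (k j : ZMod p) :
    kerA p k j ≤ 2 / ((p : ℝ) + 1) + (if k = 0 then (if j = 1 then 1 else 0) else 0) := by
  have hpos : (0 : ℝ) < (p : ℝ) + 1 := by positivity
  by_cases hk : k = 0
  · subst hk
    rw [if_pos rfl]
    split_ifs with hj
    · have : kerA p 0 j ≤ ∑ j, kerA p 0 j :=
        Finset.single_le_sum (fun j _ => kerA_nonneg 0 j) (Finset.mem_univ j)
      rw [kerA_row hp] at this
      have : 0 ≤ 2 / ((p : ℝ) + 1) := by positivity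
      linarith
    · unfold kerA
      rw [Ncirc_zero_left hp hj]
      simp only [Nat.cast_zero, zero_div, add_zero]
      positivity
  · rw [if_neg hk, add_zero]
    have h : (Ncirc p k 1 j : ℝ) ≤ 2 * (circ p k).card := by exact_mod_cast Ncirc_le hp hk j
    unfold kerA
    rw [circ_card hp hk] at h ⊢
    rw [circ_card hp one_ne_zero]
    push_cast at h ⊢
    rw [div_le_div_iff₀ (by positivity) hpos]
    nlinarith

lemma kerA_zero_le {p : ℕ} [Fact p.Prime] (hp : p % 4 = 3) (i : ZMod p) :
    kerA p i 0 ≤ 1 / ((p : ℝ) + 1) := by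
  have h : (Ncirc p i 1 0 : ℝ) ≤ (circ p i).card := by exact_mod_cast Ncirc_zero_le hp i
  have h0 : (0 : ℝ) < (circ p i).card := lt_of_le_of_ne (by positivity) (circ_card_ne hp i).symm
  unfold kerA
  rw [circ_card hp one_ne_zero]
  push_cast
  rw [div_le_div_iff₀ (by positivity) (by positivity)]
  nlinarith [show (0 : ℝ) ≤ p by positivity]

lemma kerA_sq_le {p : ℕ} [Fact p.Prime] (hp : p % 4 = 3) (i j : ZMod p) :
    (kerA p ^ 2) i j ≤ 2 / ((p : ℝ) + 1) + (if j = 1 then 1 / ((p : ℝ) + 1) else 0) := by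
  rw [sq, Matrix.mul_apply]
  calc ∑ k, kerA p i k * kerA p k j
      ≤ ∑ k, kerA p i k *
          (2 / ((p : ℝ) + 1) + (if k = 0 then (if j = 1 then 1 else 0) else 0)) :=
        Finset.sum_le_sum fun k _ => mul_le_mul_of_nonneg_left (kerA_le hp k j) (kerA_nonneg i k)
    _ = 2 / ((p : ℝ) + 1) + kerA p i 0 * (if j = 1 then 1 else 0) := by
        simp only [mul_add, Finset.sum_add_distrib, ← Finset.sum_mul, kerA_row hp, one_mul]
        simp
    _ ≤ _ := by
        have := kerA_zero_le hp i
        split_ifs <;> simp <;> simpa using this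

lemma kerA_sq_nonneg {p : ℕ} [Fact p.Prime] (i j : ZMod p) : 0 ≤ (kerA p ^ 2) i j := by
  rw [sq, Matrix.mul_apply]
  exact Finset.sum_nonneg fun k _ => mul_nonneg (kerA_nonneg _ _) (kerA_nonneg _ _)

/-- One double step contracts the `ℓ¹` norm of mean-zero functions. -/
lemma contract {p : ℕ} [Fact p.Prime] (hp : p % 4 = 3) (h : ZMod p → ℝ) (h0 : ∑ i, h i = 0) :
    ∑ j, |Matrix.vecMul h (kerA p ^ 2) j| ≤ (1 - 1 / (2 * ((p : ℝ) + 1))) * ∑ i, |h i| := by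
  set M : ZMod p → ℝ := fun j => 2 / ((p : ℝ) + 1) + (if j = 1 then 1 / ((p : ℝ) + 1) else 0)
    with hM
  have hsum : ∑ j, M j = 2 - 1 / ((p : ℝ) + 1) := by
    simp only [hM, Finset.sum_add_distrib, Finset.sum_const, Finset.card_univ, ZMod.card,
      Finset.sum_ite_eq', Finset.mem_univ, if_true, nsmul_eq_mul]
    field_simp
    ring
  have step : ∀ j, |Matrix.vecMul h (kerA p ^ 2) j| ≤ (∑ i, |h i|) * (M j / 2) := by
    intro j
    have e : Matrix.vecMul h (kerA p ^ 2) j = ∑ i, h i * ((kerA p ^ 2) i j - M j / 2) := by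
      simp only [mul_sub, Finset.sum_sub_distrib, ← Finset.sum_mul, h0, zero_mul, sub_zero]
      rfl
    rw [e, Finset.sum_mul]
    refine (Finset.abs_sum_le_sum_abs _ _).trans (Finset.sum_le_sum fun i _ => ?_)
    rw [abs_mul]
    refine mul_le_mul_of_nonneg_left ?_ (abs_nonneg _)
    have h1 := kerA_sq_le hp i j
    have h2 := kerA_sq_nonneg i j
    change _ ≤ M j at h1
    rw [abs_le]
    constructor <;> linarith
  refine (Finset.sum_le_sum fun j _ => step j).trans (le_of_eq ?_)
  rw [← Finset.mul_sum, ← Finset.sum_div, hsum]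
  field_simp

lemma vecMul_sum {p : ℕ} [Fact p.Prime] (hp : p % 4 = 3) (h : ZMod p → ℝ) :
    ∑ j, Matrix.vecMul h (kerA p) j = ∑ i, h i := by
  simp only [Matrix.vecMul, dotProduct]
  rw [Finset.sum_comm]
  simp only [← Finset.mul_sum, kerA_row hp, mul_one]

lemma vecMul_norm {p : ℕ} [Fact p.Prime] (hp : p % 4 = 3) (h : ZMod p → ℝ) :
    ∑ j, |Matrix.vecMul h (kerA p) j| ≤ ∑ i, |h i| := by
  calc ∑ j, |Matrix.vecMul h (kerA p) j| ≤ ∑ j, ∑ i, |h i| * kerA p i j := by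
        refine Finset.sum_le_sum fun j _ => (Finset.abs_sum_le_sum_abs _ _).trans (le_of_eq ?_)
        exact Finset.sum_congr rfl fun i _ => by rw [abs_mul, abs_of_nonneg (kerA_nonneg i j)]
    _ = _ := by
        rw [Finset.sum_comm]
        simp only [← Finset.mul_sum, kerA_row hp, mul_one]

lemma vecMul_pow_sum {p : ℕ} [Fact p.Prime] (hp : p % 4 = 3) (h : ZMod p → ℝ) (n : ℕ) :
    ∑ j, Matrix.vecMul h (kerA p ^ n) j = ∑ i, h i := by
  induction n with
  | zero => simp
  | succ n ih => rw [pow_succ, ← Matrix.vecMul_vecMul, vecMul_sum hp, ih]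

lemma vecMul_pow_norm {p : ℕ} [Fact p.Prime] (hp : p % 4 = 3) (h : ZMod p → ℝ) (n : ℕ) :
    ∑ j, |Matrix.vecMul h (kerA p ^ n) j| ≤ ∑ i, |h i| := by
  induction n with
  | zero => simp
  | succ n ih =>
    rw [pow_succ, ← Matrix.vecMul_vecMul]
    exact (vecMul_norm hp _).trans ih

lemma contract_pow {p : ℕ} [Fact p.Prime] (hp : p % 4 = 3) (h : ZMod p → ℝ) (h0 : ∑ i, h i = 0)
    (n : ℕ) :
    ∑ j, |Matrix.vecMul h (kerA p ^ (2 * n)) j| ≤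
      (1 - 1 / (2 * ((p : ℝ) + 1))) ^ n * ∑ i, |h i| := by
  have hr : 0 ≤ 1 - 1 / (2 * ((p : ℝ) + 1)) := by
    rw [sub_nonneg, div_le_one (by positivity)]
    linarith [show (0 : ℝ) ≤ p by positivity]
  induction n with
  | zero => simp
  | succ n ih =>
    rw [mul_add, mul_one, pow_add, ← Matrix.vecMul_vecMul]
    refine (contract hp _ ?_).trans ?_
    · rw [vecMul_pow_sum hp, h0]
    · rw [pow_succ', mul_assoc]
      exact mul_le_mul_of_nonneg_left ih hr

lemma pi_pow {p : ℕ} [Fact p.Prime] (hp : p % 4 = 3) (n : ℕ) :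
    Matrix.vecMul (piDist p) (kerA p ^ n) = piDist p := by
  induction n with
  | zero => simp
  | succ n ih =>
    rw [pow_succ, ← Matrix.vecMul_vecMul, ih]
    funext j
    exact piDist_stat hp j

/-- the mixing time of the random walk by the unit circle is `O(p)`. -/
theorem mixing_time_linear :
    ∃ C : ℝ, 0 < C ∧ ∀ (p : ℕ) [Fact p.Prime], p % 4 = 3 →
      ∀ t : ℕ, C * (p : ℝ) ≤ (t : ℝ) → ∀ i : ZMod p,
        (1 / 2) * ∑ j : ZMod p, |(kerA p ^ t) i j - piDist p j|
          ≤ 1 / (2 * Real.exp 1) := by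
  refine ⟨12, by norm_num, ?_⟩
  intro p _ hp t ht i
  have hp2 : 2 ≤ p := (Fact.out : p.Prime).two_le
  have ht' : 12 * p ≤ t := by exact_mod_cast ht
  set h : ZMod p → ℝ := Pi.single i 1 - piDist p with hh
  have h0 : ∑ j, h j = 0 := by
    simp [hh, Finset.sum_sub_distrib, piDist_sum hp]
  have hn : ∑ j, |h j| ≤ 2 := by
    calc ∑ j, |h j| ≤ ∑ j, ((Pi.single i 1 : ZMod p → ℝ) j + piDist p j) := by
          refine Finset.sum_le_sum fun j _ => ?_
          have h1 : 0 ≤ (Pi.single i 1 : ZMod p → ℝ) j := by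
            rw [Pi.single_apply]; split_ifs <;> norm_num
          have h2 := piDist_nonneg j
          rw [hh, Pi.sub_apply, abs_le]
          constructor <;> linarith
      _ = 2 := by
          rw [Finset.sum_add_distrib, piDist_sum hp]
          simp
          norm_num
  have e : ∀ j, (kerA p ^ t) i j - piDist p j = Matrix.vecMul h (kerA p ^ t) j := by
    intro j
    rw [hh, Matrix.sub_vecMul, pi_pow hp]
    simp
  simp only [e]
  set n := t / 2 with hnt
  have hn6 : 6 * p ≤ n := by omega
  have hsplit : t = 2 * n + t % 2 := by omega
  have hb : ∑ j, |Matrix.vecMul h (kerA p ^ t) j| ≤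
      (1 - 1 / (2 * ((p : ℝ) + 1))) ^ n * ∑ i, |h i| := by
    rw [hsplit, pow_add, ← Matrix.vecMul_vecMul]
    exact (vecMul_pow_norm hp _ _).trans (contract_pow hp h h0 n)
  have hr : 0 ≤ 1 - 1 / (2 * ((p : ℝ) + 1)) := by
    rw [sub_nonneg, div_le_one (by positivity)]
    linarith [show (0 : ℝ) ≤ p by positivity]
  have hexp : (1 - 1 / (2 * ((p : ℝ) + 1))) ^ n ≤ Real.exp (-2) := by
    calc (1 - 1 / (2 * ((p : ℝ) + 1))) ^ n ≤ (Real.exp (-(1 / (2 * ((p : ℝ) + 1))))) ^ n := by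
          refine pow_le_pow_left₀ hr ?_ n
          have := Real.add_one_le_exp (-(1 / (2 * ((p : ℝ) + 1))))
          linarith
      _ = Real.exp (n * -(1 / (2 * ((p : ℝ) + 1)))) := (Real.exp_nat_mul _ _).symm
      _ ≤ Real.exp (-2) := by
          apply Real.exp_le_exp.mpr
          have h1 : (6 : ℝ) * p ≤ n := by exact_mod_cast hn6
          have h2 : (2 : ℝ) ≤ p := by exact_mod_cast hp2
          have : 2 ≤ (n : ℝ) * (1 / (2 * ((p : ℝ) + 1))) := by
            rw [mul_one_div, le_div_iff₀ (by positivity)]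
            linarith
          linarith
  have hfin : Real.exp (-2) ≤ 1 / (2 * Real.exp 1) := by
    have h2 : 2 ≤ Real.exp 1 := by
      have := Real.add_one_le_exp 1
      linarith
    have h3 : Real.exp (-2) * Real.exp 1 * Real.exp 1 = 1 := by
      rw [← Real.exp_add, ← Real.exp_add]
      norm_num
    rw [le_div_iff₀ (by positivity)]
    have : 0 < Real.exp (-2) * Real.exp 1 := by positivity
    nlinarith
  calc (1 / 2) * ∑ j, |Matrix.vecMul h (kerA p ^ t) j|
      ≤ (1 / 2) * ((1 - 1 / (2 * ((p : ℝ) + 1))) ^ n * 2) := by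
        refine mul_le_mul_of_nonneg_left (hb.trans ?_) (by norm_num)
        exact mul_le_mul_of_nonneg_left hn (pow_nonneg hr n)
    _ = (1 - 1 / (2 * ((p : ℝ) + 1))) ^ n := by ring
    _ ≤ _ := hexp.trans hfin
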